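/- arXiv:2502.04619 — 9 statements merged into one kernel-verified Lean document; each statement's English description precedes it below -/
import Mathlib

section
/- For every natural number n > 6, the n-th Catalan number has a prime factor p with p ≡ 5 (mod 6) (i.e., a prime factor of the form 6k - 1). -/
/-- The product of the positive integers up to `N` that are congruent to `r` modulo `3`. -/
def residueProd (r N : ℕ) : ℕ := ∏ m ∈ Finset.range N, if (m + 1) % 3 = r then m + 1 else 1

lemma residueProd_succ (r N : ℕ) :
    residueProd r (N + 1) = residueProd r N * if (N + 1) % 3 = r then N + 1 else 1 :=
  Finset.prod_range_succ _ _

lemma residueProd_pos (r N : ℕ) : 0 < residueProd r N :=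
  Finset.prod_pos fun m _ => by split <;> omega

lemma residueProd_one_le (N : ℕ) :
    (N % 3 = 1 → residueProd 1 N ≤ N * residueProd 2 N) ∧
      (N % 3 ≠ 1 → residueProd 1 N ≤ residueProd 2 N) := by
  induction N with
  | zero => simp [residueProd]
  | succ N ih =>
    obtain ⟨h₁, h₂⟩ := ih
    rw [residueProd_succ, residueProd_succ]
    have h : (N + 1) % 3 = 0 ∨ (N + 1) % 3 = 1 ∨ (N + 1) % 3 = 2 := by omega
    rcases h with h | h | h
    · simpa [h] using h₂ (by omega)
    · have := h₂ (by omega)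
      simp only [h]
      norm_num
      nlinarith
    · have := h₁ (by omega)
      simp only [h]
      norm_num
      nlinarith [residueProd_pos 2 N]

lemma residueProd_one_le_mul {N : ℕ} (hN : 0 < N) :
    residueProd 1 N ≤ N * residueProd 2 N := by
  by_cases h : N % 3 = 1
  · exact (residueProd_one_le N).1 h
  · exact ((residueProd_one_le N).2 h).trans (Nat.le_mul_of_pos_left _ hN)

lemma factorization_eq_sum_pow_dvd {p m b : ℕ} (hp : p.Prime) (hm : 0 < m) (hb : m < p ^ b) :
    m.factorization p = ∑ i ∈ Finset.Ico 1 b, if p ^ i ∣ m then 1 else 0 := by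
  rw [← Finset.card_filter, Nat.factorization_eq_card_pow_dvd_of_lt hp hm hb]

/-- The number of positive multiples of `q` of the form `q * k` with `k ≤ T` that are
congruent to `r` modulo `3`, when `3` does not divide `q`. -/
def residueCount (r q T : ℕ) : ℕ := (T + if q % 3 = 1 then 3 - r else r) / 3

lemma residueCount_succ_div {r q : ℕ} (N : ℕ) (hr : r = 1 ∨ r = 2) (hq : q % 3 ≠ 0) :
    residueCount r q ((N + 1) / q) =
      residueCount r q (N / q) + if q ∣ N + 1 ∧ (N + 1) % 3 = r then 1 else 0 := by
  rw [Nat.succ_div]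
  by_cases h : q ∣ N + 1
  · have hk : (N + 1) / q = N / q + 1 := by rw [Nat.succ_div, if_pos h]
    have hN : N + 1 = q * (N / q + 1) := by rw [← hk, Nat.mul_div_cancel' h]
    have hmod := congrArg (· % 3) hN
    simp only [Nat.mul_mod q] at hmod
    generalize N / q = T at *
    simp only [h, residueCount, true_and, if_true]
    have hq' : q % 3 = 1 ∨ q % 3 = 2 := by omega
    have hT : T % 3 = 0 ∨ T % 3 = 1 ∨ T % 3 = 2 := by omega
    rcases hq' with h' | h' <;> rcases hr with rfl | rfl <;> rcases hT with hT | hT | hT <;>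
      simp only [h', Nat.add_mod T, hT] at hmod ⊢ <;> norm_num [hmod] <;> omega
  · simp [h]

lemma factorization_residueProd {p r N b : ℕ} (hp : p.Prime) (hp3 : p ≠ 3)
    (hr : r = 1 ∨ r = 2) (hb : N < p ^ b) :
    (residueProd r N).factorization p =
      ∑ i ∈ Finset.Ico 1 b, residueCount r (p ^ i) (N / p ^ i) := by
  have hq (i : ℕ) : p ^ i % 3 ≠ 0 := fun h =>
    hp3 ((Nat.prime_dvd_prime_iff_eq Nat.prime_three hp).1
      (Nat.prime_three.dvd_of_dvd_pow (Nat.dvd_of_mod_eq_zero h))).symm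
  induction N with
  | zero =>
    rw [Finset.sum_eq_zero]
    · simp [residueProd]
    · intro i _
      rw [residueCount, Nat.zero_div]
      split <;> omega
  | succ N ih =>
    simp only [residueCount_succ_div N hr (hq _), Finset.sum_add_distrib]
    rw [residueProd_succ, Nat.factorization_mul (residueProd_pos _ _).ne' (by split <;> omega),
      Finsupp.add_apply, ih (by omega)]
    congr 1
    split_ifs with h
    · simp [factorization_eq_sum_pow_dvd hp N.succ_pos hb, h]
    · simp [h]

lemma factorization_three_residueProd {r : ℕ} (N : ℕ) (hr : r = 1 ∨ r = 2) :
    (residueProd r N).factorization 3 = 0 := by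
  induction N with
  | zero => simp [residueProd]
  | succ N ih =>
    rw [residueProd_succ, Nat.factorization_mul (residueProd_pos _ _).ne' (by split <;> omega),
      Finsupp.add_apply, ih, zero_add]
    split_ifs with h
    · exact Nat.factorization_eq_zero_of_not_dvd (by omega)
    · simp

lemma factorial_le_mul_sq_factorial_half (M : ℕ) :
    M.factorial ≤ 2 ^ M * (M / 2 + 1) * ((M / 2).factorial * (M / 2).factorial) := by
  rw [← Nat.choose_mul_factorial_mul_factorial (Nat.div_le_self M 2)]
  have h : (M - M / 2).factorial ≤ (M / 2 + 1) * (M / 2).factorial := by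
    rw [← Nat.factorial_succ]
    exact Nat.factorial_le (by omega)
  calc M.choose (M / 2) * (M / 2).factorial * (M - M / 2).factorial
      ≤ 2 ^ M * (M / 2).factorial * ((M / 2 + 1) * (M / 2).factorial) := by
        gcongr
        exact Nat.choose_le_two_pow _ _
    _ = _ := by ring

/-- If no prime factor of `catalan n` is congruent to `5` modulo `6`, then the central binomial
coefficient is controlled by a binomial-type quotient of a third of the size. -/
lemma centralBinom_mul_dvd {n : ℕ} (hn : 0 < n)
    (h : ∀ p : ℕ, p.Prime → p ∣ catalan n → p % 6 ≠ 5) :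
    n.centralBinom * residueProd 2 (2 * n) *
        ((2 * n / 3 / 2).factorial * (2 * n / 3 / 2).factorial) ∣
      residueProd 1 (2 * n) * (2 * n / 3).factorial * ((n + 1) * (n + 1)) *
        (2 ^ n.centralBinom.factorization 2 * 2 ^ n.centralBinom.factorization 2 *
          3 ^ n.centralBinom.factorization 3) := by
  have hcb := n.centralBinom_ne_zero
  have hP (r : ℕ) := (residueProd_pos r (2 * n)).ne'
  have hf (m : ℕ) := m.factorial_ne_zero
  have h2 (k : ℕ) : 2 ^ k ≠ 0 := by positivity
  have h3 (k : ℕ) : 3 ^ k ≠ 0 := by positivity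
  have hcat : catalan n ≠ 0 := fun h0 => hcb (by
    rw [← succ_mul_catalan_eq_centralBinom, h0, mul_zero])
  refine (Nat.factorization_prime_le_iff_dvd (by simp [*]) (by simp [*])).1 fun p hp => ?_
  simp only [Nat.factorization_mul, Nat.factorization_pow, ne_eq, mul_eq_zero, hcb, hP, hf, h2, h3,
    Nat.add_one_ne_zero, or_self, not_false_eq_true, Finsupp.add_apply, Finsupp.smul_apply,
    smul_eq_mul, Nat.prime_two.factorization, Nat.prime_three.factorization]
  have hlt : 2 * n < p ^ (2 * n + 1) :=
    (Nat.lt_pow_self hp.one_lt).trans (Nat.pow_lt_pow_right hp.one_lt (by omega))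
  have hfac (m : ℕ) (hm : m ≤ 2 * n) :
      m.factorial.factorization p = ∑ i ∈ Finset.Ico 1 (2 * n + 1), m / p ^ i :=
    Nat.factorization_factorial hp ((Nat.log_mono_right hm).trans_lt
      (Nat.log_lt_of_lt_pow (by omega) hlt))
  have hcentral : n.centralBinom.factorization p =
      ∑ i ∈ Finset.Ico 1 (2 * n + 1), 2 * n / p ^ i % 2 := by
    have h := congrArg (fun m => m.factorization p)
      (Nat.choose_mul_factorial_mul_factorial (show n ≤ 2 * n by omega))
    rw [← Nat.centralBinom_eq_two_mul_choose, show 2 * n - n = n by omega] at h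
    simp only [Nat.factorization_mul, ne_eq, mul_eq_zero, hcb, hf, or_self, not_false_eq_true,
      Finsupp.add_apply, hfac n (by omega), hfac (2 * n) le_rfl] at h
    have h' : ∑ i ∈ Finset.Ico 1 (2 * n + 1), 2 * n / p ^ i =
        ∑ i ∈ Finset.Ico 1 (2 * n + 1), (2 * n / p ^ i % 2 + n / p ^ i + n / p ^ i) :=
      Finset.sum_congr rfl fun i _ => by
        have : n / p ^ i = 2 * n / p ^ i / 2 := by
          rw [Nat.div_div_eq_div_mul, mul_comm (p ^ i), Nat.mul_div_mul_left _ _ two_pos]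
        omega
    simp only [Finset.sum_add_distrib] at h'
    omega
  have hthird (i : ℕ) : 2 * n / 3 / p ^ i = 2 * n / p ^ i / 3 := by
    rw [Nat.div_div_eq_div_mul, Nat.div_div_eq_div_mul, mul_comm 3]
  have hsixth (i : ℕ) : 2 * n / 3 / 2 / p ^ i = 2 * n / p ^ i / 6 := by
    rw [Nat.div_div_eq_div_mul _ 3 2, Nat.div_div_eq_div_mul, Nat.div_div_eq_div_mul, mul_comm (3 * 2)]
  rw [hfac _ (show 2 * n / 3 ≤ 2 * n by omega), hfac _ (show 2 * n / 3 / 2 ≤ 2 * n by omega)]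
  simp only [hthird, hsixth]
  by_cases hp3 : p = 3
  · subst hp3
    have key : ∑ i ∈ Finset.Ico 1 (2 * n + 1), (2 * n / 3 ^ i / 6 + 2 * n / 3 ^ i / 6) ≤
        ∑ i ∈ Finset.Ico 1 (2 * n + 1), 2 * n / 3 ^ i / 3 :=
      Finset.sum_le_sum fun i _ => by omega
    rw [Finset.sum_add_distrib] at key
    rw [factorization_three_residueProd _ (.inr rfl), factorization_three_residueProd _ (.inl rfl)]
    simp
    omega
  rw [factorization_residueProd hp hp3 (.inr rfl) hlt,
    factorization_residueProd hp hp3 (.inl rfl) hlt]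
  by_cases hp1 : p % 3 = 1
  · have key : ∑ i ∈ Finset.Ico 1 (2 * n + 1), (2 * n / p ^ i % 2 +
          residueCount 2 (p ^ i) (2 * n / p ^ i) + (2 * n / p ^ i / 6 + 2 * n / p ^ i / 6)) ≤
        ∑ i ∈ Finset.Ico 1 (2 * n + 1),
          (residueCount 1 (p ^ i) (2 * n / p ^ i) + 2 * n / p ^ i / 3) :=
      Finset.sum_le_sum fun i _ => by
        have hq : p ^ i % 3 = 1 := by simp [Nat.pow_mod, hp1]
        simp only [residueCount, hq, if_true]
        generalize 2 * n / p ^ i = T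
        have hT : T % 6 = 0 ∨ T % 6 = 1 ∨ T % 6 = 2 ∨ T % 6 = 3 ∨ T % 6 = 4 ∨ T % 6 = 5 := by omega
        rcases hT with hT | hT | hT | hT | hT | hT <;> omega
    simp only [Finset.sum_add_distrib, ← hcentral] at key
    omega
  · have key : ∑ i ∈ Finset.Ico 1 (2 * n + 1), (residueCount 2 (p ^ i) (2 * n / p ^ i) +
          (2 * n / p ^ i / 6 + 2 * n / p ^ i / 6)) ≤
        ∑ i ∈ Finset.Ico 1 (2 * n + 1),
          (residueCount 1 (p ^ i) (2 * n / p ^ i) + 2 * n / p ^ i / 3 + 2 * n / p ^ i % 2) :=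
      Finset.sum_le_sum fun i _ => by
        simp only [residueCount]
        generalize 2 * n / p ^ i = T
        have hT : T % 6 = 0 ∨ T % 6 = 1 ∨ T % 6 = 2 ∨ T % 6 = 3 ∨ T % 6 = 4 ∨ T % 6 = 5 := by omega
        split <;> rcases hT with hT | hT | hT | hT | hT | hT <;> omega
    simp only [Finset.sum_add_distrib, ← hcentral] at key
    by_cases hp2 : p = 2
    · subst hp2
      simp
      omega
    · have hndvd : ¬ p ∣ catalan n := fun hd => h p hp hd <| by
        have := hp.eq_one_or_self_of_dvd 2
        have := hp.eq_one_or_self_of_dvd 3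
        omega
      have : n.centralBinom.factorization p = (n + 1).factorization p := by
        rw [← succ_mul_catalan_eq_centralBinom, Nat.factorization_mul n.succ_ne_zero hcat,
          Finsupp.add_apply, Nat.factorization_eq_zero_of_not_dvd hndvd, add_zero]
      omega

lemma four_pow_le_of_forall_prime_dvd_catalan {n : ℕ} (hn : 0 < n)
    (h : ∀ p : ℕ, p.Prime → p ∣ catalan n → p % 6 ≠ 5) :
    4 ^ n ≤ (2 * n) ^ 5 * (n + 1) ^ 3 * 2 ^ (2 * n / 3) := by
  have hdvd := Nat.le_of_dvd (by
    have := residueProd_pos 1 (2 * n)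
    positivity) (centralBinom_mul_dvd hn h)
  have hpow (p : ℕ) : p ^ n.centralBinom.factorization p ≤ 2 * n :=
    Nat.pow_factorization_choose_le (by omega)
  have hP := residueProd_pos 2 (2 * n)
  set F := (2 * n / 3 / 2).factorial * (2 * n / 3 / 2).factorial with hF
  have hFpos : 0 < F := by positivity
  have hcb : n.centralBinom ≤ (2 * n) ^ 4 * (n + 1) ^ 3 * 2 ^ (2 * n / 3) := by
    refine Nat.le_of_mul_le_mul_right (c := residueProd 2 (2 * n) * F) ?_ (by positivity)
    calc n.centralBinom * (residueProd 2 (2 * n) * F)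
        ≤ residueProd 1 (2 * n) * (2 * n / 3).factorial * ((n + 1) * (n + 1)) *
          (2 ^ n.centralBinom.factorization 2 * 2 ^ n.centralBinom.factorization 2 *
          3 ^ n.centralBinom.factorization 3) := by rwa [← mul_assoc]
      _ ≤ (2 * n * residueProd 2 (2 * n)) * (2 ^ (2 * n / 3) * (n + 1) * F) *
          ((n + 1) * (n + 1)) * (2 * n * (2 * n) * (2 * n)) := by
        gcongr
        · exact residueProd_one_le_mul (by omega)
        · refine (factorial_le_mul_sq_factorial_half _).trans ?_
          gcongr
          omega
        all_goals exact hpow _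
      _ = _ := by ring
  calc 4 ^ n ≤ 2 * n * n.centralBinom := Nat.four_pow_le_two_mul_self_mul_centralBinom n hn
    _ ≤ 2 * n * ((2 * n) ^ 4 * (n + 1) ^ 3 * 2 ^ (2 * n / 3)) := by gcongr
    _ = _ := by ring

lemma mul_sq_lt_two_pow {k : ℕ} (hk : 16 ≤ k) : 49 * k ^ 2 < 2 ^ k := by
  induction k, hk using Nat.le_induction with
  | base => norm_num
  | succ k hk ih =>
    rw [pow_succ 2]
    nlinarith

lemma mul_two_pow_lt_four_pow {n : ℕ} (hn : 48 ≤ n) :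
    (2 * n) ^ 5 * (n + 1) ^ 3 * 2 ^ (2 * n / 3) < 4 ^ n := by
  have poly : (2 * n) ^ 5 * (n + 1) ^ 3 < 2 ^ (2 * n - 2 * n / 3) := by
    obtain ⟨k, hk⟩ : ∃ k, k = n / 3 := ⟨_, rfl⟩
    calc (2 * n) ^ 5 * (n + 1) ^ 3 ≤ (7 * k) ^ 5 * (7 * k) ^ 3 :=
        Nat.mul_le_mul (Nat.pow_le_pow_left (by omega) _) (Nat.pow_le_pow_left (by omega) _)
      _ = (49 * k ^ 2) ^ 4 := by ring
      _ < (2 ^ k) ^ 4 := by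
        gcongr
        exact mul_sq_lt_two_pow (by omega)
      _ = 2 ^ (k * 4) := (pow_mul _ _ _).symm
      _ ≤ 2 ^ (2 * n - 2 * n / 3) := by
        gcongr
        · norm_num
        · omega
  calc (2 * n) ^ 5 * (n + 1) ^ 3 * 2 ^ (2 * n / 3)
      < 2 ^ (2 * n - 2 * n / 3) * 2 ^ (2 * n / 3) := by gcongr
    _ = 4 ^ n := by
      rw [← pow_add, Nat.sub_add_cancel (show 2 * n / 3 ≤ 2 * n by omega), pow_mul]
      norm_num

lemma prime_dvd_catalan {n p : ℕ} (hp : p.Prime) (h₁ : n + 1 < p) (h₂ : p ≤ 2 * n) :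
    p ∣ catalan n := by
  have h : p ∣ (n + 1) * catalan n := by
    rw [succ_mul_catalan_eq_centralBinom]
    exact hp.dvd_choose (by omega) (by omega) h₂
  exact (hp.dvd_mul.1 h).resolve_left (Nat.not_dvd_of_pos_of_lt n.succ_pos h₁)

theorem catalan_has_prime_factor_6k_sub_1 (n : ℕ) (hn : 6 < n) :
    ∃ p : ℕ, p.Prime ∧ p ∣ catalan n ∧ p % 6 = 5 := by
  obtain hn' | hn' := le_or_gt 48 n
  · by_contra! h
    exact (four_pow_le_of_forall_prime_dvd_catalan (by omega) h).not_gt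
      (mul_two_pow_lt_four_pow hn')
  · have hcases : ∃ p ∈ [11, 17, 29, 53], n + 1 < p ∧ p ≤ 2 * n := by
      interval_cases n <;> decide
    obtain ⟨p, hp, h₁, h₂⟩ := hcases
    have hprime : p.Prime ∧ p % 6 = 5 := by
      fin_cases hp <;> norm_num
    exact ⟨p, hprime.1, prime_dvd_catalan hprime.1 h₁ h₂, hprime.2⟩
end

section
/- For every positive integer k, the sum of divisors σ(12k - 1) is divisible by 12. -/
theorem ZMod.add_eq_zero_of_mul_eq_neg_one_twelve :
    ∀ a b : ZMod 12, a * b = -1 → a + b = 0 := by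
  decide

theorem ZMod.mul_self_ne_neg_one_twelve : ∀ a : ZMod 12, a * a ≠ -1 := by
  decide

theorem twelve_dvd_sigma_twelve_k_sub_one (k : ℕ) (hk : 0 < k) :
    12 ∣ ∑ d ∈ (12 * k - 1).divisors, d := by
  have hn : ((12 * k - 1 : ℕ) : ZMod 12) = -1 := by
    rw [Nat.cast_sub (by omega), Nat.cast_mul, ZMod.natCast_self]
    simp
  have hn0 : 12 * k - 1 ≠ 0 := by omega
  generalize 12 * k - 1 = n at hn hn0
  have hmul : ∀ d ∈ n.divisors, (d : ZMod 12) * ((n / d : ℕ) : ZMod 12) = -1 := by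
    intro d hd
    rw [← Nat.cast_mul, Nat.mul_div_cancel' (Nat.dvd_of_mem_divisors hd), hn]
  rw [← ZMod.natCast_eq_zero_iff, Nat.cast_sum]
  refine Finset.sum_involution (fun d _ ↦ n / d) ?_ ?_ ?_ ?_
  · exact fun d hd ↦ ZMod.add_eq_zero_of_mul_eq_neg_one_twelve _ _ (hmul d hd)
  · intro d hd _ heq
    have h := hmul d hd
    rw [heq] at h
    exact ZMod.mul_self_ne_neg_one_twelve _ h
  · exact fun d hd ↦ Nat.mem_divisors.2 ⟨Nat.div_dvd_of_dvd (Nat.dvd_of_mem_divisors hd), hn0⟩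
  · exact fun d hd ↦ Nat.div_div_self (Nat.dvd_of_mem_divisors hd) hn0
end

section
/- For every positive integer k, the sum of divisors σ(24k - 1) is divisible by 24. -/
lemma ZMod.add_eq_zero_of_mul_eq_neg_one_twentyfour :
    ∀ a b : ZMod 24, a * b = -1 → a + b = 0 := by
  decide

lemma ZMod.mul_self_ne_neg_one_twentyfour : ∀ a : ZMod 24, a * a ≠ -1 := by
  decide

theorem twentyfour_dvd_sigma_twentyfour_k_sub_one (k : ℕ) (hk : 0 < k) :
    24 ∣ ∑ d ∈ (24 * k - 1).divisors, d := by
  have hn : ((24 * k - 1 : ℕ) : ZMod 24) = -1 := by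
    have h24 : (24 : ZMod 24) = 0 := by decide
    rw [Nat.cast_sub (by omega)]
    push_cast
    rw [h24]
    ring
  have hmul : ∀ d ∈ (24 * k - 1).divisors,
      (d : ZMod 24) * ((24 * k - 1) / d : ℕ) = -1 := by
    intro d hd
    rw [← Nat.cast_mul, Nat.mul_div_cancel' (Nat.dvd_of_mem_divisors hd), hn]
  rw [← ZMod.natCast_eq_zero_iff, Nat.cast_sum]
  refine Finset.sum_involution (fun d _ => (24 * k - 1) / d) ?_ ?_ ?_ ?_
  · exact fun d hd => ZMod.add_eq_zero_of_mul_eq_neg_one_twentyfour _ _ (hmul d hd)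
  · intro d hd _ heq
    have h := hmul d hd
    rw [heq] at h
    exact ZMod.mul_self_ne_neg_one_twentyfour _ h
  · intro d hd
    exact Nat.mem_divisors.2
      ⟨Nat.div_dvd_of_dvd (Nat.dvd_of_mem_divisors hd), by omega⟩
  · intro d hd
    exact Nat.div_div_self (Nat.dvd_of_mem_divisors hd) (by omega)
end

section
/- For every natural number n > 6, the sum of divisors σ(catalan n) of the n-th Catalan number is divisible by 6. -/
open Finset
open scoped ArithmeticFunction.vonMangoldt ArithmeticFunction.zeta ArithmeticFunction.sigma

/-! ### Divisibility from one prime exponent -/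

theorem six_dvd_sum_divisors_of_factorization_eq_one {m p : ℕ} (hp : p.Prime) (hp6 : p % 6 = 5)
    (h : m.factorization p = 1) : 6 ∣ ∑ d ∈ m.divisors, d := by
  have hm : m ≠ 0 := by rintro rfl; simp at h
  have hcop := Nat.coprime_ordCompl hp hm
  have hdec := Nat.ordProj_mul_ordCompl_eq_self m p
  rw [h, pow_one] at hdec hcop
  rw [← ArithmeticFunction.sigma_one_apply, ← hdec,
    ArithmeticFunction.isMultiplicative_sigma.map_mul_of_coprime hcop]
  refine Dvd.dvd.mul_right ?_ _
  have := ArithmeticFunction.sigma_one_apply_prime_pow (i := 1) hp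
  simp only [pow_one, sum_range_succ, sum_range_zero, pow_zero, zero_add] at this
  rw [this]
  lia

theorem factorization_centralBinom_eq_one {n p : ℕ} (hp : p.Prime) (hlt : 2 * n < p * p)
    (hodd : 2 * n / p % 2 = 1) : n.centralBinom.factorization p = 1 := by
  have hlog : Nat.log p (2 * n) < 2 := Nat.log_lt_of_lt_pow' (by norm_num) (by rwa [pow_two])
  rw [Nat.centralBinom, Nat.factorization_choose hp (by lia) hlog]
  have hcarry : p ≤ n % p + n % p := by
    by_contra! hlt'
    have h2 : 2 * n / p = 2 * (n / p) := by
      have := Nat.div_add_mod n p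
      generalize n / p = q, n % p = r at *
      exact Nat.div_eq_of_lt_le (by nlinarith) (by nlinarith)
    lia
  have hsub : 2 * n - n = n := by lia
  rw [hsub, show Ico 1 2 = ({1} : Finset ℕ) from rfl, filter_singleton]
  simp [hcarry]

theorem factorization_catalan_eq_one {n p : ℕ} (hp : p.Prime) (hlt : 2 * n < p * p)
    (hodd : 2 * n / p % 2 = 1) (hdvd : ¬ p ∣ n + 1) : (catalan n).factorization p = 1 := by
  have h := factorization_centralBinom_eq_one hp hlt hodd
  rw [← succ_mul_catalan_eq_centralBinom] at h
  have h0 : catalan n ≠ 0 := by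
    rintro h0
    simp [h0] at h
  rwa [Nat.factorization_mul (by lia) h0, Finsupp.add_apply,
    Nat.factorization_eq_zero_of_not_dvd hdvd, zero_add] at h

theorem six_dvd_sigma_catalan_of_prime {n p : ℕ} (hp : p.Prime) (hp6 : p % 6 = 5)
    (hlo : n + 1 < p) (hhi : p ≤ 2 * n) : 6 ∣ ∑ d ∈ (catalan n).divisors, d := by
  refine six_dvd_sum_divisors_of_factorization_eq_one hp hp6
    (factorization_catalan_eq_one hp (by nlinarith) ?_ fun h ↦ ?_)
  · rw [Nat.div_eq_of_lt_le (k := 1) (by lia) (by lia)]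
  · exact absurd (Nat.le_of_dvd (by lia) h) (by lia)

/-! ### Sums over the von Mangoldt function -/

theorem sum_log_eq_log_factorial (n : ℕ) :
    ∑ m ∈ Ioc 0 n, Real.log m = Real.log n.factorial := by
  induction n with
  | zero => simp
  | succ n ih =>
    rw [Finset.sum_Ioc_succ_top (by lia), ih, Nat.factorial_succ, Nat.cast_mul,
      Real.log_mul (by positivity) (by positivity), add_comm]

theorem log_factorial_eq_sum {n N : ℕ} (h : n ≤ N) :
    Real.log n.factorial = ∑ d ∈ Ioc 0 N, Λ d * ((n / d : ℕ) : ℝ) := by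
  have h1 := ArithmeticFunction.sum_Ioc_mul_zeta_eq_sum (R := ℝ) Λ n
  rw [ArithmeticFunction.vonMangoldt_mul_zeta] at h1
  simp only [ArithmeticFunction.log_apply] at h1
  rw [← sum_log_eq_log_factorial, h1]
  refine sum_subset (Ioc_subset_Ioc_right h) fun d hd hd' ↦ ?_
  simp only [mem_Ioc] at hd hd'
  rw [Nat.div_eq_of_lt (by lia)]
  simp

theorem log_centralBinom_eq_sum (n : ℕ) :
    Real.log n.centralBinom = ∑ d ∈ Ioc 0 (2 * n), Λ d * ((2 * n / d % 2 : ℕ) : ℝ) := by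
  have h : Real.log (2 * n).factorial =
      Real.log n.centralBinom + 2 * Real.log n.factorial := by
    have := Nat.choose_mul_factorial_mul_factorial (n := 2 * n) (k := n) (by lia)
    rw [show 2 * n - n = n by lia] at this
    rw [← this, ← Nat.centralBinom]
    have := n.centralBinom_pos
    push_cast
    rw [Real.log_mul (by positivity) (by positivity), Real.log_mul (by positivity) (by positivity)]
    ring
  rw [log_factorial_eq_sum le_rfl, log_factorial_eq_sum (show n ≤ 2 * n by lia)] at h
  rw [← sub_eq_iff_eq_add] at h
  rw [← h, mul_sum, ← sum_sub_distrib]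
  refine sum_congr rfl fun d _ ↦ ?_
  have h2 : n / d = 2 * n / d / 2 := by
    rw [Nat.div_div_eq_div_mul, mul_comm d 2, Nat.mul_div_mul_left _ _ (by norm_num)]
  have h3 : ((2 * n / d : ℕ) : ℝ) = 2 * ((2 * n / d / 2 : ℕ) : ℝ) + ((2 * n / d % 2 : ℕ) : ℝ) := by
    exact_mod_cast (Nat.div_add_mod (2 * n / d) 2).symm
  rw [h2, h3]
  ring

/-- The nontrivial character modulo `3`, as a real-valued arithmetic function. -/
noncomputable def chiThree : ArithmeticFunction ℝ :=
  ⟨fun n ↦ if n % 3 = 1 then 1 else if n % 3 = 2 then -1 else 0, by simp⟩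

theorem chiThree_apply (n : ℕ) :
    chiThree n = if n % 3 = 1 then 1 else if n % 3 = 2 then -1 else 0 := rfl

theorem chiThree_mul (a b : ℕ) : chiThree (a * b) = chiThree a * chiThree b := by
  simp only [chiThree_apply, Nat.mul_mod a b]
  have ha := Nat.mod_lt a (show 3 > 0 by norm_num)
  have hb := Nat.mod_lt b (show 3 > 0 by norm_num)
  interval_cases a % 3 <;> interval_cases b % 3 <;> simp

theorem sum_chiThree (n : ℕ) :
    ∑ m ∈ Ioc 0 n, chiThree m = if n % 3 = 1 then 1 else 0 := by
  induction n with
  | zero => simp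
  | succ n ih =>
    rw [Finset.sum_Ioc_succ_top (by lia), ih, chiThree_apply]
    have : n % 3 = 0 ∨ n % 3 = 1 ∨ n % 3 = 2 := by lia
    rcases this with h | h | h <;> simp [h, Nat.add_mod]

theorem sum_chiThree_mul_log_eq (n : ℕ) :
    ∑ m ∈ Ioc 0 n, chiThree m * Real.log m =
      ∑ d ∈ Ioc 0 n, Λ d * (chiThree d * if n / d % 3 = 1 then 1 else 0) := by
  have h := ArithmeticFunction.sum_Ioc_mul_eq_sum_sum (chiThree.pmul Λ) chiThree n
  simp only [sum_chiThree, ArithmeticFunction.pmul_apply] at h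
  convert h using 1
  · refine sum_congr rfl fun m _ ↦ ?_
    rw [ArithmeticFunction.mul_apply, ← ArithmeticFunction.log_apply,
      ← ArithmeticFunction.vonMangoldt_mul_zeta, ArithmeticFunction.mul_apply, mul_sum]
    refine sum_congr rfl fun x hx ↦ ?_
    obtain ⟨rfl, hx0⟩ := Nat.mem_divisorsAntidiagonal.1 hx
    have : x.2 ≠ 0 := by rintro h; simp [h] at hx0
    simp [chiThree_mul, ArithmeticFunction.pmul_apply, this]
    ring
  · exact sum_congr rfl fun d _ ↦ by ring

theorem sum_chiThree_mul_log_le (n : ℕ) :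
    ∑ m ∈ Ioc 0 n, chiThree m * Real.log m ≤ Real.log n := by
  have key : ∀ k : ℕ, ∑ m ∈ Ioc 0 (3 * k), chiThree m * Real.log m ≤ 0 := by
    intro k
    induction k with
    | zero => simp
    | succ k ih =>
      rw [show 3 * (k + 1) = 3 * k + 1 + 1 + 1 by ring, Finset.sum_Ioc_succ_top (by lia),
        Finset.sum_Ioc_succ_top (by lia), Finset.sum_Ioc_succ_top (by lia)]
      have : Real.log ((3 * k + 1 : ℕ) : ℝ) ≤ Real.log ((3 * k + 1 + 1 : ℕ) : ℝ) :=
        Real.log_le_log (by positivity) (by push_cast; linarith)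
      simp [chiThree_apply, Nat.add_mod] at this ih ⊢
      linarith
  obtain ⟨k, hk⟩ : ∃ k, n = 3 * k ∨ n = 3 * k + 1 ∨ n = 3 * k + 1 + 1 := ⟨n / 3, by lia⟩
  have h := key k
  rcases hk with rfl | rfl | rfl
  · exact h.trans (Real.log_natCast_nonneg _)
  · rw [Finset.sum_Ioc_succ_top (by lia)]
    simp [chiThree_apply, Nat.add_mod] at h ⊢
    linarith
  · have h0 := Real.log_natCast_nonneg (3 * k + 1 + 1)
    have : Real.log ((3 * k + 1 : ℕ) : ℝ) ≤ Real.log ((3 * k + 1 + 1 : ℕ) : ℝ) :=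
      Real.log_le_log (by positivity) (by push_cast; linarith)
    rw [Finset.sum_Ioc_succ_top (by lia), Finset.sum_Ioc_succ_top (by lia)]
    simp [chiThree_apply, Nat.add_mod] at h h0 this ⊢
    linarith

/-! ### The large case -/

theorem vonMangoldt_weight_le {n d : ℕ} (hn : 5 ≤ n)
    (H : ∀ p : ℕ, p.Prime → p % 6 = 5 → (catalan n).factorization p ≠ 1)
    (hd : d ∈ Ioc 0 (2 * n)) :
    Λ d * (((2 * n / d % 2 : ℕ) : ℝ) - chiThree d * (if 2 * n / d % 3 = 1 then 1 else 0)) ≤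
      (if d ≤ 2 * n / 3 ∧ d.Prime then Λ d else 0) + 2 * (if ¬ d.Prime then Λ d else 0) +
      2 * (if d ≤ Nat.sqrt (2 * n) ∧ d.Prime then Λ d else 0) +
      2 * (if d ∣ n + 1 then Λ d else 0) := by
  rw [mem_Ioc] at hd
  have hΛ : 0 ≤ Λ d := ArithmeticFunction.vonMangoldt_nonneg
  have hw : ((2 * n / d % 2 : ℕ) : ℝ) - chiThree d * (if 2 * n / d % 3 = 1 then 1 else 0) ≤ 2 := by
    have : 2 * n / d % 2 = 0 ∨ 2 * n / d % 2 = 1 := by lia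
    rw [chiThree_apply]
    rcases this with h | h <;> rw [h] <;> split_ifs <;> norm_num
  have hw' := mul_le_mul_of_nonneg_left hw hΛ
  by_cases hp : d.Prime
  swap
  · refine hw'.trans ?_
    simp only [hp, and_false, not_false_eq_true, if_true, if_false]
    split_ifs <;> linarith
  by_cases hs : d ≤ Nat.sqrt (2 * n)
  · simp only [hp, hs, and_true, not_true_eq_false, if_true, if_false]
    refine hw'.trans ?_
    split_ifs <;> linarith
  by_cases hdvd : d ∣ n + 1
  · simp only [hp, hs, hdvd, and_true, not_true_eq_false, if_true, if_false]
    refine hw'.trans ?_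
    split_ifs <;> linarith
  simp only [hp, hs, hdvd, and_true, not_true_eq_false, if_false, mul_zero, add_zero]
  have hlt : 2 * n < d * d := Nat.sqrt_lt.1 (not_le.1 hs)
  have hd3 : 3 < d := by
    by_contra! h
    have : d * d ≤ 3 * 3 := Nat.mul_le_mul h h
    lia
  have hj : 1 ≤ 2 * n / d := (Nat.one_le_div_iff hd.1).2 hd.2
  have hthree : d ≤ 2 * n / 3 ↔ 3 ≤ 2 * n / d := by
    rw [Nat.le_div_iff_mul_le (by norm_num), Nat.le_div_iff_mul_le hd.1, mul_comm]
  simp only [hthree]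
  have hmod3 : d % 3 ≠ 0 := fun h ↦ by
    have := (Nat.prime_dvd_prime_iff_eq Nat.prime_three hp).1 (Nat.dvd_of_mod_eq_zero h)
    lia
  have hmod2 : d % 2 ≠ 0 := fun h ↦ by
    have := (Nat.prime_dvd_prime_iff_eq Nat.prime_two hp).1 (Nat.dvd_of_mod_eq_zero h)
    lia
  have hweight : ((2 * n / d % 2 : ℕ) : ℝ) -
      chiThree d * (if 2 * n / d % 3 = 1 then 1 else 0) ≤ if 3 ≤ 2 * n / d then 1 else 0 := by
    rw [chiThree_apply]
    have hpar : 2 * n / d % 2 = 0 ∨ 2 * n / d % 2 = 1 := by lia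
    rcases (show d % 3 = 1 ∨ d % 3 = 2 by lia) with h | h
    · by_cases hj3 : 3 ≤ 2 * n / d
      · rcases hpar with h' | h' <;> rw [h'] <;> simp only [h, hj3] <;> split_ifs <;> norm_num
      · rcases (show 2 * n / d = 1 ∨ 2 * n / d = 2 by lia) with h' | h' <;> simp [h, h']
    · have heven : 2 * n / d % 2 = 0 := hpar.resolve_right fun h' ↦
        H d hp (by lia) (factorization_catalan_eq_one hp hlt h' hdvd)
      rw [heven]
      by_cases hj3 : 3 ≤ 2 * n / d
      · simp only [h, hj3]
        split_ifs <;> norm_num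
      · have h' : 2 * n / d = 2 := by lia
        simp [h']
  refine (mul_le_mul_of_nonneg_left hweight hΛ).trans_eq ?_
  split_ifs <;> simp

theorem sum_prime_vonMangoldt_eq_theta {M N : ℕ} (h : M ≤ N) :
    ∑ d ∈ Ioc 0 N, (if d ≤ M ∧ d.Prime then Λ d else 0) = Chebyshev.theta M := by
  rw [Chebyshev.theta, Nat.floor_natCast, ← sum_filter]
  have : (Ioc 0 N).filter (fun d ↦ d ≤ M ∧ d.Prime) = (Ioc 0 M).filter Nat.Prime := by
    ext d
    simp only [mem_filter, mem_Ioc]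
    constructor <;> rintro ⟨_, _⟩ <;> refine ⟨?_, ?_⟩ <;> grind
  rw [this]
  exact sum_congr rfl fun d hd ↦ ArithmeticFunction.vonMangoldt_apply_prime (mem_filter.1 hd).2

theorem sum_dvd_vonMangoldt_le (m N : ℕ) (hm : m ≠ 0) :
    ∑ d ∈ Ioc 0 N, (if d ∣ m then Λ d else 0) ≤ Real.log m := by
  rw [← ArithmeticFunction.vonMangoldt_sum, ← sum_filter]
  refine sum_le_sum_of_subset_of_nonneg (fun d hd ↦ ?_)
    fun _ _ _ ↦ ArithmeticFunction.vonMangoldt_nonneg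
  exact Nat.mem_divisors.2 ⟨(mem_filter.1 hd).2, hm⟩

theorem log_centralBinom_le {n : ℕ} (hn : 5 ≤ n)
    (H : ∀ p : ℕ, p.Prime → p % 6 = 5 → (catalan n).factorization p ≠ 1) :
    Real.log n.centralBinom ≤ Real.log (2 * n : ℕ) + Chebyshev.theta (2 * n / 3 : ℕ) +
      2 * (Chebyshev.psi (2 * n : ℕ) - Chebyshev.theta (2 * n : ℕ)) +
      2 * Chebyshev.theta (Nat.sqrt (2 * n)) + 2 * Real.log (n + 1 : ℕ) := by
  have h := sum_le_sum fun d hd ↦ vonMangoldt_weight_le (d := d) hn H hd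
  simp only [mul_sub, sum_sub_distrib, sum_add_distrib, ← mul_sum] at h
  rw [← log_centralBinom_eq_sum, ← sum_chiThree_mul_log_eq,
    sum_prime_vonMangoldt_eq_theta (Nat.div_le_self _ _),
    sum_prime_vonMangoldt_eq_theta (Nat.sqrt_le_self _), ← sum_filter] at h
  have h1 := Chebyshev.psi_sub_theta_eq_sum_not_prime (2 * n : ℕ)
  rw [Nat.floor_natCast] at h1
  rw [← h1] at h
  have h2 := sum_chiThree_mul_log_le (2 * n)
  have h3 := sum_dvd_vonMangoldt_le (n + 1) (2 * n) (by lia)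
  linarith

theorem exists_prime_factorization_catalan_eq_one {n : ℕ} (hn : 2 ^ 17 ≤ n) :
    ∃ p : ℕ, p.Prime ∧ p % 6 = 5 ∧ (catalan n).factorization p = 1 := by
  by_contra! H
  have hle := log_centralBinom_le (by lia) H
  have hN : ((2 : ℝ) ^ 18) ≤ ((2 * n : ℕ) : ℝ) := by exact_mod_cast (by lia : 2 ^ 18 ≤ 2 * n)
  have hlower : 2 * n * Real.log 2 ≤ Real.log (2 * n : ℕ) + Real.log n.centralBinom := by
    have h := Nat.four_pow_le_two_mul_self_mul_centralBinom n (by lia)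
    have h' : ((4 : ℝ) ^ n) ≤ ((2 * n : ℕ) : ℝ) * n.centralBinom := by exact_mod_cast h
    have h0 := n.centralBinom_pos
    have := Real.log_le_log (by positivity) h'
    rw [Real.log_mul (by positivity) (by positivity), Real.log_pow,
      show (4 : ℝ) = 2 ^ 2 by norm_num, Real.log_pow] at this
    push_cast at this ⊢
    linarith
  have hlog4 : Real.log 4 = 2 * Real.log 2 := by
    rw [show (4 : ℝ) = 2 ^ 2 by norm_num, Real.log_pow]; norm_num
  have hcast : ((2 * n / 3 : ℕ) : ℝ) ≤ ((2 * n : ℕ) : ℝ) / 3 := Nat.cast_div_le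
  have hsqrt : ((Nat.sqrt (2 * n) : ℕ) : ℝ) ≤ √((2 * n : ℕ) : ℝ) := Real.nat_sqrt_le_real_sqrt
  have ht1 := Chebyshev.theta_le_log4_mul_x (Nat.cast_nonneg (α := ℝ) (2 * n / 3))
  have ht2 := Chebyshev.theta_le_log4_mul_x (Nat.cast_nonneg (α := ℝ) (Nat.sqrt (2 * n)))
  have hpsi := (le_abs_self _).trans
    (Chebyshev.abs_psi_sub_theta_le_sqrt_mul_log (x := (2 * n : ℕ)) (by linarith))
  have hsucc : Real.log (n + 1 : ℕ) ≤ Real.log (2 * n : ℕ) :=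
    Real.log_le_log (by positivity) (by exact_mod_cast (by lia : n + 1 ≤ 2 * n))
  have hNn : (2 : ℝ) * n = ((2 * n : ℕ) : ℝ) := by push_cast; rfl
  rw [hNn] at hlower
  generalize ((2 * n : ℕ) : ℝ) = N at *
  obtain ⟨s, hs⟩ : ∃ s, s = √N := ⟨_, rfl⟩
  have hsN : N = s ^ 2 := by rw [hs, Real.sq_sqrt (by linarith)]
  have hs512 : 512 ≤ s := by
    rw [hs]
    exact Real.le_sqrt_of_sq_le (by linarith)
  have hl2 := Real.log_two_gt_d9
  have hl2' := Real.log_two_lt_d9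
  have hlogs : Real.log s ≤ s / 512 + 5.24 := by
    have h := Real.log_le_sub_one_of_pos (show 0 < s / 2 ^ 9 by positivity)
    rw [Real.log_div (by positivity) (by positivity), Real.log_pow] at h
    norm_num at h ⊢
    linarith
  have hlogN : Real.log N = 2 * Real.log s := by rw [hsN, Real.log_pow]; norm_num
  rw [← hs] at hsqrt hpsi
  rw [hlogN] at hpsi hlower hle hsucc
  have hmain : s ^ 2 * Real.log 2 / 3 ≤ 8 * s * Real.log s + 4 * Real.log 2 * s +
      8 * Real.log s := by
    rw [hlog4] at ht1 ht2
    have e1 : 2 * Real.log 2 * ((2 * n / 3 : ℕ) : ℝ) ≤ 2 * Real.log 2 * (N / 3) := by gcongr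
    have e2 : 2 * Real.log 2 * ((Nat.sqrt (2 * n) : ℕ) : ℝ) ≤ 2 * Real.log 2 * s := by gcongr
    rw [← hsN]
    linarith
  nlinarith

theorem six_dvd_sigma_catalan (n : ℕ) (hn : 6 < n) :
    6 ∣ ∑ d ∈ (catalan n).divisors, d := by
  rcases le_or_gt (2 ^ 17) n with h | h
  · obtain ⟨p, hp, hp6, h1⟩ := exists_prime_factorization_catalan_eq_one h
    exact six_dvd_sum_divisors_of_factorization_eq_one hp hp6 h1
  · suffices ∃ p : ℕ, p.Prime ∧ p % 6 = 5 ∧ n + 1 < p ∧ p ≤ 2 * n by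
      obtain ⟨p, hp, hp6, hlo, hhi⟩ := this
      exact six_dvd_sigma_catalan_of_prime hp hp6 hlo hhi
    by_contra! H
    have h0 := H 11 (by norm_num) (by norm_num)
    have h1 := H 17 (by norm_num) (by norm_num)
    have h2 := H 29 (by norm_num) (by norm_num)
    have h3 := H 53 (by norm_num) (by norm_num)
    have h4 := H 101 (by norm_num) (by norm_num)
    have h5 := H 197 (by norm_num) (by norm_num)
    have h6 := H 389 (by norm_num) (by norm_num)
    have h7 := H 773 (by norm_num) (by norm_num)
    have h8 := H 1523 (by norm_num) (by norm_num)
    have h9 := H 3041 (by norm_num) (by norm_num)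
    have h10 := H 6053 (by norm_num) (by norm_num)
    have h11 := H 12101 (by norm_num) (by norm_num)
    have h12 := H 24197 (by norm_num) (by norm_num)
    have h13 := H 48383 (by norm_num) (by norm_num)
    have h14 := H 96749 (by norm_num) (by norm_num)
    have h15 := H 193493 (by norm_num) (by norm_num)
    lia
end

section
/- For every positive integer k, k! * catalan(2k) = 2^k * ∏_{j=1}^{k-1} (2k + 1 + 2j), where the product over an empty range equals 1. -/
open scoped Nat

theorem doubleFactorial_mul_prod_Icc (a n : ℕ) :
    (2 * a + 1)‼ * ∏ j ∈ Finset.Icc 1 n, (2 * a + 1 + 2 * j) = (2 * a + 2 * n + 1)‼ := by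
  induction n with
  | zero => simp
  | succ n ih =>
    rw [Finset.prod_Icc_succ_top (by lia), ← mul_assoc, ih,
      show 2 * a + 2 * (n + 1) + 1 = 2 * a + 2 * n + 1 + 2 by ring, Nat.doubleFactorial_add_two]
    ring

theorem centralBinom_succ_mul_factorial (n : ℕ) :
    (n + 1).centralBinom * (n + 1)! = 2 ^ (n + 1) * (2 * n + 1)‼ := by
  have h := Nat.choose_mul_factorial_mul_factorial (show n + 1 ≤ 2 * (n + 1) by lia)
  rw [show 2 * (n + 1) - (n + 1) = n + 1 by lia, ← Nat.centralBinom_eq_two_mul_choose,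
    show 2 * (n + 1) = 2 * n + 1 + 1 by ring, Nat.factorial_eq_mul_doubleFactorial (2 * n + 1),
    show 2 * n + 1 + 1 = 2 * (n + 1) by ring, Nat.doubleFactorial_two_mul] at h
  apply Nat.eq_of_mul_eq_mul_right (Nat.factorial_pos (n + 1))
  rw [h]
  ring

theorem factorial_mul_catalan_even (k : ℕ) (hk : 0 < k) :
    Nat.factorial k * catalan (2 * k) = 2 ^ k * ∏ j ∈ Finset.Icc 1 (k - 1), (2 * k + 1 + 2 * j) := by
  obtain ⟨m, rfl⟩ := Nat.exists_eq_add_of_le' hk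
  rw [Nat.add_sub_cancel]
  have hcb := centralBinom_succ_mul_factorial (2 * m + 1)
  have hprod := doubleFactorial_mul_prod_Icc (m + 1) m
  have hfac := Nat.factorial_eq_mul_doubleFactorial (2 * m + 1)
  rw [show 2 * m + 1 + 1 = 2 * (m + 1) by ring] at hcb hfac
  rw [Nat.doubleFactorial_two_mul] at hfac
  rw [← succ_mul_catalan_eq_centralBinom, hfac,
    show 2 * (2 * m + 1) + 1 = 2 * (m + 1) + 2 * m + 1 by ring, ← hprod,
    show (2 * (m + 1) + 1)‼ = (2 * (m + 1) + 1) * (2 * m + 1)‼ from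
      Nat.doubleFactorial_add_two (2 * m + 1)] at hcb
  have hpos : 0 < (2 * (m + 1) + 1) * (2 * m + 1)‼ * 2 ^ (m + 1) := by
    have := Nat.doubleFactorial_pos (2 * m + 1)
    positivity
  apply Nat.eq_of_mul_eq_mul_left hpos
  linear_combination hcb
end

section
/- For every positive integer k, k! * catalan(2k - 1) = 2^(k-1) * ∏_{j=1}^{k-1} (2k - 1 + 2j), where the product over an empty range equals 1. -/
theorem add_two_mul_catalan_succ (n : ℕ) :
    (n + 2) * catalan (n + 1) = 2 * (2 * n + 1) * catalan n := by
  have h := Nat.succ_mul_centralBinom_succ n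
  rw [← succ_mul_catalan_eq_centralBinom, ← succ_mul_catalan_eq_centralBinom] at h
  apply Nat.eq_of_mul_eq_mul_left (show 0 < n + 1 from n.succ_pos)
  linear_combination h

theorem prod_range_odd_succ (m : ℕ) :
    (∏ j ∈ Finset.range (m + 1), (2 * m + 5 + 2 * j)) * (2 * m + 3) =
      (∏ j ∈ Finset.range m, (2 * m + 3 + 2 * j)) * (4 * m + 3) * (4 * m + 5) := by
  have h := Finset.prod_range_succ' (fun j => 2 * m + 3 + 2 * j) (m + 1)
  rw [Finset.prod_range_succ, Finset.prod_range_succ] at h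
  calc
    _ = (∏ j ∈ Finset.range (m + 1), (2 * m + 3 + 2 * (j + 1))) * (2 * m + 3 + 2 * 0) := by
      congr 1
      exact Finset.prod_congr rfl fun j _ => by ring
    _ = _ := by rw [← h]; ring

theorem factorial_succ_mul_catalan (m : ℕ) :
    (m + 1).factorial * catalan (2 * m + 1) =
      2 ^ m * ∏ j ∈ Finset.range m, (2 * m + 3 + 2 * j) := by
  induction m with
  | zero => simp
  | succ m ih =>
    have h₁ := add_two_mul_catalan_succ (2 * m + 1)
    have h₂ := add_two_mul_catalan_succ (2 * m + 2)
    have hP := prod_range_odd_succ m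
    rw [show 2 * (m + 1) + 1 = 2 * m + 2 + 1 by ring, show 2 * (m + 1) + 3 = 2 * m + 5 by ring,
      Nat.factorial_succ (m + 1)]
    apply Nat.eq_of_mul_eq_mul_left (show 0 < 2 * (2 * m + 3) by positivity)
    generalize (m + 1).factorial = f at *
    rw [show 2 * m + 1 + 1 = 2 * m + 2 by ring] at h₁
    linear_combination (2 * m + 3) * f * h₂ + 2 * (4 * m + 5) * f * h₁ +
      4 * (4 * m + 3) * (4 * m + 5) * ih - 4 * 2 ^ m * hP

theorem factorial_mul_catalan_odd (k : ℕ) (hk : 0 < k) :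
    Nat.factorial k * catalan (2 * k - 1) = 2 ^ (k - 1) * ∏ j ∈ Finset.Icc 1 (k - 1), (2 * k - 1 + 2 * j) := by
  obtain ⟨m, rfl⟩ := Nat.exists_eq_add_one.mpr hk
  rw [show 2 * (m + 1) - 1 = 2 * m + 1 by lia, Nat.add_sub_cancel, factorial_succ_mul_catalan,
    ← Finset.Ico_add_one_right_eq_Icc, Finset.prod_Ico_eq_prod_range, Nat.add_sub_cancel]
  congr 1
  exact Finset.prod_congr rfl fun j _ => by ring
end

section
/- For every positive integer k, the 2-adic valuation of catalan(2k - 1) equals (k - 1) minus the 2-adic valuation of k!, i.e., v_2(catalan(2k - 1)) = k - 1 - v_2(k!). -/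
theorem factorial_succ_mul_factorial_mul_catalan (n : ℕ) :
    (n + 1).factorial * n.factorial * catalan n = (2 * n).factorial := by
  have h := Nat.choose_mul_factorial_mul_factorial (show n ≤ 2 * n by omega)
  rw [← Nat.centralBinom_eq_two_mul_choose, ← succ_mul_catalan_eq_centralBinom,
    show 2 * n - n = n by omega] at h
  rw [← h, Nat.factorial_succ]
  ring

theorem two_adic_val_catalan_odd_index (k : ℕ) (hk : 0 < k) :
    padicValNat 2 (catalan (2 * k - 1)) = k - 1 - padicValNat 2 (Nat.factorial k) := by
  have hcat := factorial_succ_mul_factorial_mul_catalan (2 * k - 1)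
  have hne : catalan (2 * k - 1) ≠ 0 := by
    intro h
    rw [h, mul_zero] at hcat
    exact Nat.factorial_ne_zero _ hcat.symm
  have hval := congrArg (padicValNat 2) hcat
  rw [padicValNat.mul (mul_ne_zero (Nat.factorial_ne_zero _) (Nat.factorial_ne_zero _)) hne,
    padicValNat.mul (Nat.factorial_ne_zero _) (Nat.factorial_ne_zero _),
    show 2 * k - 1 + 1 = 2 * k by omega, padicValNat_factorial_mul,
    padicValNat_factorial_mul] at hval
  omega
end

section
/- For every positive integer k, the Catalan number catalan(2k - 1) is odd if and only if v_2(k!) = k - 1, which holds if and only if k is a power of 2. -/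
theorem catalan_mul_factorial_succ_mul_factorial (n : ℕ) :
    catalan n * (n + 1).factorial * n.factorial = (2 * n).factorial := by
  have h := Nat.choose_mul_factorial_mul_factorial (Nat.le_mul_of_pos_left n two_pos)
  rw [← Nat.centralBinom_eq_two_mul_choose, ← succ_mul_catalan_eq_centralBinom,
    show 2 * n - n = n by lia] at h
  rw [← h, Nat.factorial_succ]
  ring

theorem catalan_ne_zero (n : ℕ) : catalan n ≠ 0 := by
  intro h
  have := catalan_mul_factorial_succ_mul_factorial n
  rw [h, zero_mul, zero_mul] at this
  exact (2 * n).factorial_ne_zero this.symm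

theorem padicValNat_two_catalan_add_factorial_succ (n : ℕ) :
    padicValNat 2 (catalan n) + padicValNat 2 (n + 1).factorial = n := by
  have h := congrArg (padicValNat 2) (catalan_mul_factorial_succ_mul_factorial n)
  rw [padicValNat.mul (mul_ne_zero (catalan_ne_zero n) (Nat.factorial_ne_zero _))
    (Nat.factorial_ne_zero _), padicValNat.mul (catalan_ne_zero n) (Nat.factorial_ne_zero _),
    padicValNat_factorial_mul] at h
  lia

theorem odd_iff_padicValNat_two_eq_zero {n : ℕ} (hn : n ≠ 0) :
    Odd n ↔ padicValNat 2 n = 0 := by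
  rw [← Nat.not_even_iff_odd, even_iff_two_dvd, dvd_iff_padicValNat_ne_zero hn, not_not]

theorem padicValNat_two_factorial_eq_sub_one_iff {k : ℕ} (hk : 0 < k) :
    padicValNat 2 k.factorial = k - 1 ↔ ∃ m : ℕ, k = 2 ^ m := by
  induction k using Nat.strong_induction_on with
  | h k ih =>
    obtain ⟨j, rfl | rfl⟩ := k.even_or_odd'
    · rw [padicValNat_factorial_mul]
      have hj : 0 < j := by lia
      rw [show padicValNat 2 j.factorial + j = 2 * j - 1 ↔ padicValNat 2 j.factorial = j - 1 by
        lia, ih j (by lia) hj]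
      constructor
      · rintro ⟨m, rfl⟩
        exact ⟨m + 1, by ring⟩
      · rintro ⟨_ | m, hm⟩
        · lia
        · exact ⟨m, by rw [pow_succ] at hm; lia⟩
    · rw [padicValNat_factorial_mul_add j one_lt_two, padicValNat_factorial_mul]
      constructor
      · intro h
        by_cases hj : j = 0
        · exact ⟨0, by simp [hj]⟩
        · have := padicValNat_factorial_lt_of_ne_zero 2 hj
          lia
      · rintro ⟨_ | m, hm⟩
        · obtain rfl : j = 0 := by simpa using hm
          simp
        · rw [pow_succ] at hm
          lia

theorem catalan_odd_iff_val_iff_pow_two (k : ℕ) (hk : 0 < k) :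
    (Odd (catalan (2 * k - 1)) ↔ padicValNat 2 (Nat.factorial k) = k - 1) ∧
    (padicValNat 2 (Nat.factorial k) = k - 1 ↔ ∃ m : ℕ, k = 2 ^ m) := by
  refine ⟨?_, padicValNat_two_factorial_eq_sub_one_iff hk⟩
  have h := padicValNat_two_catalan_add_factorial_succ (2 * k - 1)
  rw [show 2 * k - 1 + 1 = 2 * k by lia, padicValNat_factorial_mul] at h
  rw [odd_iff_padicValNat_two_eq_zero (catalan_ne_zero _)]
  lia
end

section
/- For every natural number n, the n-th Catalan number catalan n is odd if and only if n + 1 is a power of 2, i.e., if and only if n = 2^m - 1 for some natural number m. -/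
open Finset.HasAntidiagonal (antidiagonal mem_antidiagonal)

/-- In characteristic two, the off-diagonal terms of a self-convolution cancel in pairs. -/
theorem CharTwo.sum_antidiagonal_mul_self {R : Type*} [CommRing R] [CharP R 2] (f : ℕ → R)
    (n : ℕ) :
    ∑ p ∈ antidiagonal n, f p.1 * f p.2 =
      ∑ p ∈ antidiagonal n with p.1 = p.2, f p.1 * f p.2 := by
  rw [← Finset.sum_filter_add_sum_filter_not _ (fun p : ℕ × ℕ => p.1 = p.2), add_eq_left]
  refine Finset.sum_involution (fun p _ => p.swap) ?_ ?_ ?_ ?_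
  · intro p _
    rw [Prod.fst_swap, Prod.snd_swap, mul_comm (f p.2), CharTwo.add_self_eq_zero]
  · intro p hp _ h
    exact (Finset.mem_filter.mp hp).2 (congrArg Prod.snd h)
  · intro p hp
    simp only [Finset.mem_filter, mem_antidiagonal, Prod.fst_swap, Prod.snd_swap] at hp ⊢
    omega
  · intro p _
    exact p.swap_swap

theorem cast_catalan_succ_zmod_two (n : ℕ) :
    (catalan (n + 1) : ZMod 2) =
      ∑ p ∈ antidiagonal n with p.1 = p.2, (catalan p.1 : ZMod 2) * catalan p.2 := by
  rw [catalan_succ', Nat.cast_sum]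
  simp only [Nat.cast_mul]
  exact CharTwo.sum_antidiagonal_mul_self (fun i => (catalan i : ZMod 2)) n

theorem odd_catalan_two_mul_add_one (k : ℕ) : Odd (catalan (2 * k + 1)) ↔ Odd (catalan k) := by
  have h : (antidiagonal (2 * k)).filter (fun p => p.1 = p.2) = {(k, k)} := by
    ext ⟨i, j⟩
    simp only [Finset.mem_filter, mem_antidiagonal, Finset.mem_singleton, Prod.mk.injEq]
    omega
  have h' := cast_catalan_succ_zmod_two (2 * k)
  rw [h, Finset.sum_singleton, ← Nat.cast_mul] at h'
  rw [← ZMod.natCast_eq_one_iff_odd, h', ZMod.natCast_eq_one_iff_odd, Nat.odd_mul, and_self]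

theorem even_catalan_two_mul_add_two (k : ℕ) : Even (catalan (2 * k + 2)) := by
  rw [← ZMod.natCast_eq_zero_iff_even, cast_catalan_succ_zmod_two, Finset.filter_eq_empty_iff.mpr,
    Finset.sum_empty]
  intro p hp
  rw [mem_antidiagonal] at hp
  omega

theorem catalan_odd_iff_mersenne (n : ℕ) :
    Odd (catalan n) ↔ ∃ m : ℕ, n = 2 ^ m - 1 := by
  induction n using Nat.strong_induction_on with
  | _ n ih =>
    obtain rfl | ⟨k, rfl | rfl⟩ : n = 0 ∨ ∃ k, n = 2 * k + 1 ∨ n = 2 * k + 2 := by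
      have : n = 0 ∨ n = 2 * ((n - 1) / 2) + 1 ∨ n = 2 * ((n - 1) / 2) + 2 := by omega
      exact this.imp_right fun h => ⟨_, h⟩
    · exact iff_of_true (by simp) ⟨0, rfl⟩
    · rw [odd_catalan_two_mul_add_one, ih k (by omega)]
      constructor
      · rintro ⟨m, hm⟩
        have := Nat.two_pow_pos m
        exact ⟨m + 1, by rw [pow_succ]; omega⟩
      · rintro ⟨_ | m, hm⟩
        · simp at hm
        · rw [pow_succ] at hm
          exact ⟨m, by omega⟩
    · refine iff_of_false (Nat.not_odd_iff_even.mpr (even_catalan_two_mul_add_two k)) ?_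
      rintro ⟨_ | m, hm⟩
      · simp at hm
      · rw [pow_succ] at hm
        omega
end
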